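/- Let A be a positive integer with exactly n base-10 digits and let A* be its base-10 reversal. If A × A* has exactly 2n − 1 base-10 digits and is a palindrome, then (A, A*) is a polynomial pair. -/

import Mathlib

/-- The `i`-th base-10 digit of `N` (0 if out of range). -/
def digit (N i : ℕ) : ℕ := (Nat.digits 10 N).getD i 0

/-- The polynomial whose coefficient of `X ^ i` is the `i`-th base-10 digit of `N`. -/
noncomputable def digitPoly (N : ℕ) : Polynomial ℕ :=
  ∑ i ∈ Finset.range (Nat.digits 10 N).length, Polynomial.C (digit N i) * Polynomial.X ^ i

/-- The base-10 reversal of `N`. -/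
def rev (N : ℕ) : ℕ := Nat.ofDigits 10 (Nat.digits 10 N).reverse

/-- The multiplication of `A` by `B` can be performed without carry in base 10:
every convolution sum of digits is at most 9. -/
def NoCarryMul (A B : ℕ) : Prop :=
  ∀ k, ∑ i ∈ Finset.range (k + 1), digit A i * digit B (k - i) ≤ 9

/-- The maximum base-10 digit of `N`. -/
def maxDigit (N : ℕ) : ℕ := (Nat.digits 10 N).foldr max 0

/-- The sum of the base-10 digits of `N`. -/
def digitSum (N : ℕ) : ℕ := (Nat.digits 10 N).sum

/-- The `i`-th base-`b` digit of `N` (0 if out of range). -/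
def digitB (b N i : ℕ) : ℕ := (Nat.digits b N).getD i 0

/-- The base-`b` reversal of `N`. -/
def revB (b N : ℕ) : ℕ := Nat.ofDigits b (Nat.digits b N).reverse

/-- The multiplication of `A` by `B` can be performed without carry in base `b`:
every convolution sum of base-`b` digits is at most `b - 1`. -/
def NoCarryMulB (b A B : ℕ) : Prop :=
  ∀ k, ∑ i ∈ Finset.range (k + 1), digitB b A i * digitB b B (k - i) ≤ b - 1

section

open Polynomial

theorem coeff_digitPoly (N k : ℕ) : (digitPoly N).coeff k = digit N k := by
  simp only [digitPoly, finsetSum_coeff, coeff_C_mul_X_pow, Finset.sum_ite_eq, Finset.mem_range]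
  split_ifs with h
  · rfl
  · exact (List.getD_eq_default _ _ (not_lt.mp h)).symm

theorem digit_eq_div_mod (N i : ℕ) : digit N i = N / 10 ^ i % 10 :=
  Nat.getD_digits N i (by norm_num)

theorem digit_eq_zero_of_length_le {N i : ℕ} (h : (Nat.digits 10 N).length ≤ i) :
    digit N i = 0 :=
  List.getD_eq_default _ _ h

theorem eval_digitPoly (N : ℕ) : (digitPoly N).eval 10 = N := by
  conv_rhs => rw [← Nat.ofDigits_digits 10 N, Nat.ofDigits_eq_sum_mapIdx]
  rw [digitPoly, eval_finsetSum, List.mapIdx_eq_ofFn, List.sum_ofFn, Finset.sum_range]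
  simp [digit]

/-- The digits of the number written by a list of decimal digits are the entries of the list. -/
theorem digit_ofDigits {L : List ℕ} (h : ∀ d ∈ L, d < 10) (i : ℕ) :
    digit (Nat.ofDigits 10 L) i = L.getD i 0 := by
  rw [digit_eq_div_mod]
  induction L generalizing i with
  | nil => simp
  | cons d L ih =>
    have hd : d < 10 := h d (by simp)
    rw [Nat.ofDigits_cons]
    cases i with
    | zero => simp; omega
    | succ i =>
      rw [pow_succ', ← Nat.div_div_eq_div_mul, List.getD_cons_succ,
        Nat.add_mul_div_left _ _ (by norm_num), Nat.div_eq_of_lt hd, zero_add,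
        ih fun e he => h e (by simp [he])]

theorem digits_reverse_lt {N : ℕ} : ∀ d ∈ (Nat.digits 10 N).reverse, d < 10 := fun d hd =>
  Nat.digits_lt_base (by norm_num) (List.mem_reverse.mp hd)

theorem digit_rev (N i : ℕ) : digit (rev N) i = (Nat.digits 10 N).reverse.getD i 0 :=
  digit_ofDigits digits_reverse_lt i

theorem digit_rev_of_le {N m i : ℕ} (hm : (Nat.digits 10 N).length = m + 1) (hi : i ≤ m) :
    digit (rev N) i = digit N (m - i) := by
  rw [digit_rev, digit, List.getD_eq_getElem _ _ (by simp; omega),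
    List.getD_eq_getElem _ _ (by omega), List.getElem_reverse]
  congr 1
  omega

theorem digit_rev_of_lt {N m i : ℕ} (hm : (Nat.digits 10 N).length = m + 1) (hi : m < i) :
    digit (rev N) i = 0 := by
  rw [digit_rev, List.getD_eq_default _ _ (by simp; omega)]

theorem digitPoly_rev {N m : ℕ} (hm : (Nat.digits 10 N).length = m + 1) :
    digitPoly (rev N) = reflect m (digitPoly N) := by
  ext i
  rw [coeff_reflect, coeff_digitPoly, coeff_digitPoly]
  rcases le_or_gt i m with hi | hi
  · rw [revAt_le hi, digit_rev_of_le hm hi]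
  · rw [revAt_eq_self_of_lt hi, digit_rev_of_lt hm hi, digit_eq_zero_of_length_le (by omega)]

theorem natDegree_digitPoly_le {N m : ℕ} (h : ∀ i, m < i → digit N i = 0) :
    (digitPoly N).natDegree ≤ m :=
  natDegree_le_iff_coeff_eq_zero.mpr fun i hi => by rw [coeff_digitPoly, h i hi]

theorem coeff_digitPoly_mul (A B k : ℕ) :
    (digitPoly A * digitPoly B).coeff k =
      ∑ i ∈ Finset.range (k + 1), digit A i * digit B (k - i) := by
  rw [coeff_mul, Finset.Nat.sum_antidiagonal_eq_sum_range_succ_mk]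
  simp only [coeff_digitPoly]

/-- If the coefficients `s` of a base-`b` expansion and the genuine base-`b` digits of its value
are both symmetric about `m / 2`, and the value has at most `m + 1` digits, then no carry occurs. -/
theorem lt_of_symmetric_expansion {b m P : ℕ} (hb : 0 < b) (s : ℕ → ℕ)
    (hs : ∀ k ≤ m, s (m - k) = s k) (hP : P = ∑ i ∈ Finset.range (m + 1), s i * b ^ i)
    (hlt : P < b ^ (m + 1)) (hsymm : ∀ k ≤ m, P / b ^ (m - k) % b = P / b ^ k % b) :
    ∀ k ≤ m, s k < b := by
  set r : ℕ → ℕ := fun k => (∑ i ∈ Finset.range k, s i * b ^ i) / b ^ k with hr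
  have r_zero : r 0 = 0 := by simp [hr]
  have r_top : r (m + 1) = 0 := by rw [hr]; dsimp only; rw [← hP, Nat.div_eq_of_lt hlt]
  have r_succ (k : ℕ) : r (k + 1) = (s k + r k) / b := by
    simp only [hr]
    rw [Finset.sum_range_succ, pow_succ, ← Nat.div_div_eq_div_mul,
      Nat.add_mul_div_right _ _ (pow_pos hb k), add_comm]
  have digit_eq {k : ℕ} (hk : k ≤ m) : P / b ^ k % b = (s k + r k) % b := by
    have hdvd : b ^ (k + 1) ∣ ∑ i ∈ Finset.Ico (k + 1) (m + 1), s i * b ^ i :=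
      Finset.dvd_sum fun i hi => (pow_dvd_pow b (Finset.mem_Ico.mp hi).1).mul_left _
    obtain ⟨q, hq⟩ := hdvd
    rw [hP, ← Finset.sum_range_add_sum_Ico _ (Nat.succ_le_succ hk), hq, Finset.sum_range_succ,
      show ∀ T, T + s k * b ^ k + b ^ (k + 1) * q = T + (s k + b * q) * b ^ k by intro T; ring,
      Nat.add_mul_div_right _ _ (pow_pos hb k)]
    rw [show ∀ R, R + (s k + b * q) = s k + R + b * q by intro R; ring, Nat.add_mul_mod_self_left]
  have step {k : ℕ} (hk : k ≤ m) : s k + r k = P / b ^ k % b + b * r (k + 1) := by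
    rw [digit_eq hk, r_succ, Nat.mod_add_div]
  have r_eq_zero (k : ℕ) (hk : k ≤ m + 1) : r k = 0 ∧ r (m + 1 - k) = 0 := by
    induction k with
    | zero => exact ⟨r_zero, r_top⟩
    | succ k ih =>
      obtain ⟨h₁, h₂⟩ := ih (by omega)
      have e₁ := step (show k ≤ m by omega)
      have e₂ := step (show m - k ≤ m by omega)
      rw [hs k (by omega), hsymm k (by omega), show m - k + 1 = m + 1 - k by omega, h₂] at e₂
      rw [h₁] at e₁
      have hmul : b * r (k + 1) = 0 := by omega
      refine ⟨(Nat.mul_eq_zero.mp hmul).resolve_left hb.ne', ?_⟩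
      rw [show m + 1 - (k + 1) = m - k by omega]
      omega
  intro k hk
  have e := step hk
  rw [(r_eq_zero k (by omega)).1, (r_eq_zero (k + 1) (by omega)).1] at e
  have := Nat.mod_lt (P / b ^ k) hb
  omega

end

/-- if `A` has exactly `n` base-10 digits and `A × A*` is a palindrome
with exactly `2n - 1` base-10 digits, then `(A, A*)` is a polynomial pair. -/
theorem stmt15 (A n : ℕ) (hA : 0 < A) (hn : (Nat.digits 10 A).length = n)
    (hlen : (Nat.digits 10 (A * rev A)).length = 2 * n - 1)
    (hpal : rev (A * rev A) = A * rev A) :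
    NoCarryMul A (rev A) := by
  obtain ⟨m, hm⟩ : ∃ m, (Nat.digits 10 A).length = m + 1 :=
    Nat.exists_eq_succ_of_ne_zero (by simp [Nat.digits_ne_nil_iff_ne_zero, hA.ne'])
  obtain rfl : n = m + 1 := hn.symm.trans hm
  replace hlen : (Nat.digits 10 (A * rev A)).length = m + m + 1 := by omega
  have degA : (digitPoly A).natDegree ≤ m :=
    natDegree_digitPoly_le fun i hi => digit_eq_zero_of_length_le (by omega)
  have degB : (digitPoly (rev A)).natDegree ≤ m :=
    natDegree_digitPoly_le fun i hi => digit_rev_of_lt hm hi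
  have deg : (digitPoly A * digitPoly (rev A)).natDegree ≤ m + m :=
    Polynomial.natDegree_mul_le_of_le degA degB
  have hreflect : Polynomial.reflect (m + m) (digitPoly A * digitPoly (rev A)) =
      digitPoly A * digitPoly (rev A) := by
    rw [Polynomial.reflect_mul _ _ degA degB, digitPoly_rev hm, Polynomial.reflect_reflect,
      mul_comm]
  intro k
  rw [← coeff_digitPoly_mul]
  rcases le_or_gt k (m + m) with hk | hk
  · refine Nat.lt_succ_iff.mp (lt_of_symmetric_expansion (P := A * rev A) (by norm_num) _
      (fun k hk => ?_) ?_ ?_ (fun k hk => ?_) k hk)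
    · conv_rhs => rw [← hreflect, Polynomial.coeff_reflect, Polynomial.revAt_le hk]
    · rw [← Polynomial.eval_eq_sum_range' (Nat.lt_succ_of_le deg), Polynomial.eval_mul]
      exact congrArg₂ _ (eval_digitPoly _).symm (eval_digitPoly _).symm
    · rw [← hlen]
      exact Nat.lt_base_pow_length_digits (by norm_num)
    · have h := digit_rev_of_le hlen hk
      rw [hpal, digit_eq_div_mod, digit_eq_div_mod] at h
      exact h.symm
  · rw [Polynomial.coeff_eq_zero_of_natDegree_lt (deg.trans_lt hk)]
    exact Nat.zero_le _
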